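/- arXiv:2310.12437 — 2 statements merged into one kernel-verified Lean document; each statement's English description precedes it below -/
import Mathlib

section
/- Let p ∈ [2, ∞) and let (X, Y) be a random pair in ℝ^d × ℝ with E[|Y|^p] < ∞ and E[|X^j|^p] < ∞ for all j ∈ {1,…,d}. Then the risk R_p(w) = E[ℓ_p(⟨w, X⟩ − Y)] is twice (Fréchet) differentiable at every w ∈ ℝ^d, with Hessian ∇²R_p(w) = E[|⟨w, X⟩ − Y|^{p−2} X Xᵀ]. -/
open MeasureTheory RealInnerProductSpace

/-- Differentiation under the expectation for a function of the residual `⟪w, X⟫ - Y` multiplied by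
a random vector `V`. -/
theorem hasFDerivAt_integral_residual_smul {Ω E F : Type*} [MeasurableSpace Ω] {P : Measure Ω}
    [NormedAddCommGroup E] [InnerProductSpace ℝ E] [MeasurableSpace E] [BorelSpace E]
    [SecondCountableTopology E]
    [NormedAddCommGroup F] [NormedSpace ℝ F] {X : Ω → E} {Y : Ω → ℝ} {V : Ω → F}
    (hX : Measurable X) (hY : Measurable Y) (hV : AEStronglyMeasurable V P)
    {f f' : ℝ → ℝ} (hf : ∀ t, HasDerivAt f (f' t) t) (hf' : Measurable f')
    {w : E} {bound : Ω → ℝ} (hbound : Integrable bound P)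
    (hle : ∀ ω t, |t| ≤ (‖w‖ + 1) * ‖X ω‖ + |Y ω| → |f' t| * ‖X ω‖ * ‖V ω‖ ≤ bound ω)
    (hint : Integrable (fun ω => f (⟪w, X ω⟫ - Y ω) • V ω) P) :
    Integrable (fun ω => (f' (⟪w, X ω⟫ - Y ω) • innerSL ℝ (X ω)).smulRight (V ω)) P ∧
      HasFDerivAt (fun u => ∫ ω, f (⟪u, X ω⟫ - Y ω) • V ω ∂P)
        (∫ ω, (f' (⟪w, X ω⟫ - Y ω) • innerSL ℝ (X ω)).smulRight (V ω) ∂P) w := by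
  have hres : ∀ u : E, Measurable fun ω => ⟪u, X ω⟫ - Y ω := fun u =>
    (measurable_const.inner hX).sub hY
  have hfm : Measurable f :=
    (continuous_iff_continuousAt.2 fun t => (hf t).continuousAt).measurable
  have hmeas : AEStronglyMeasurable
      (fun ω => (f' (⟪w, X ω⟫ - Y ω) • innerSL ℝ (X ω)).smulRight (V ω)) P := by
    have h1 : AEStronglyMeasurable (fun ω => innerSL ℝ (X ω)) P :=
      (innerSL ℝ).continuous.comp_aestronglyMeasurable hX.aestronglyMeasurable
    have h2 : AEStronglyMeasurable (fun ω => f' (⟪w, X ω⟫ - Y ω) • innerSL ℝ (X ω)) P :=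
      (hf'.comp (hres w)).aestronglyMeasurable.smul h1
    exact isBoundedBilinearMap_smulRight.continuous.comp_aestronglyMeasurable
      (h2.prodMk hV)
  have hderiv : ∀ ω u, HasFDerivAt (fun u => f (⟪u, X ω⟫ - Y ω) • V ω)
      ((f' (⟪u, X ω⟫ - Y ω) • innerSL ℝ (X ω)).smulRight (V ω)) u := by
    intro ω u
    have h1 : HasFDerivAt (fun u => ⟪u, X ω⟫ - Y ω) (innerSL ℝ (X ω)) u := by
      have h := ((innerSL ℝ (X ω)).hasFDerivAt (x := u)).sub_const (Y ω)
      simpa [real_inner_comm] using h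
    exact ((hf _).comp_hasFDerivAt u h1).smul_const (V ω)
  have hnorm : ∀ ω, ∀ u ∈ Metric.ball w 1,
      ‖(f' (⟪u, X ω⟫ - Y ω) • innerSL ℝ (X ω)).smulRight (V ω)‖ ≤ bound ω := by
    intro ω u hu
    rw [ContinuousLinearMap.norm_smulRight_apply, norm_smul, innerSL_apply_norm, Real.norm_eq_abs]
    apply hle
    have hu' : ‖u‖ ≤ ‖w‖ + 1 := by
      have := norm_sub_norm_le u w
      have := mem_ball_iff_norm.1 hu
      linarith
    calc |⟪u, X ω⟫ - Y ω| ≤ |⟪u, X ω⟫| + |Y ω| := abs_sub _ _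
      _ ≤ ‖u‖ * ‖X ω‖ + |Y ω| := by gcongr; exact abs_real_inner_le_norm _ _
      _ ≤ _ := by gcongr
  have hs : Metric.ball w 1 ∈ nhds w := Metric.ball_mem_nhds w one_pos
  refine ⟨hbound.mono' hmeas (.of_forall fun ω => hnorm ω w (mem_of_mem_nhds hs)), ?_⟩
  exact hasFDerivAt_integral_of_dominated_of_fderiv_le hs
    (.of_forall fun u => (hfm.comp (hres u)).aestronglyMeasurable.smul hV) hint hmeas
    (.of_forall hnorm) hbound (.of_forall fun ω u _ => hderiv ω u)

theorem sign_mul_abs_rpow_sub_one (p t : ℝ) :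
    Real.sign t * |t| ^ (p - 1) = |t| ^ (p - 2) * t := by
  rcases eq_or_ne t 0 with rfl | ht
  · simp
  · have h : |t| ^ (p - 1) = |t| ^ (p - 2) * |t| := by
      rw [← Real.rpow_add_one (abs_ne_zero.2 ht)]; ring_nf
    rw [h]
    rcases ht.lt_or_gt with h0 | h0
    · rw [Real.sign_of_neg h0, abs_of_neg h0]; ring
    · rw [Real.sign_of_pos h0, abs_of_pos h0]; ring

theorem hasDerivAt_abs_rpow_div {p : ℝ} (hp : 1 < p) (t : ℝ) :
    HasDerivAt (fun t => |t| ^ p / (p * (p - 1))) (Real.sign t * |t| ^ (p - 1) / (p - 1)) t := by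
  refine ((hasDerivAt_abs_rpow t hp).div_const (p * (p - 1))).congr_deriv ?_
  rw [sign_mul_abs_rpow_sub_one]
  have : p ≠ 0 := by linarith
  have : p - 1 ≠ 0 := by linarith
  field_simp

theorem hasDerivAt_sign_mul_abs_rpow_div {p : ℝ} (hp : 2 ≤ p) (t : ℝ) :
    HasDerivAt (fun t => Real.sign t * |t| ^ (p - 1) / (p - 1)) (|t| ^ (p - 2)) t := by
  have hp1 : p - 1 ≠ 0 := by linarith
  rcases lt_trichotomy t 0 with ht | rfl | ht
  · have h : HasDerivAt (fun t : ℝ => -(-t) ^ (p - 1) / (p - 1)) (|t| ^ (p - 2)) t := by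
      refine ((((hasDerivAt_id t).neg).rpow_const (p := p - 1)
        (Or.inr (by linarith))).neg.div_const (p - 1)).congr_deriv ?_
      simp only [id, abs_of_neg ht, Pi.neg_apply]
      rw [show p - 1 - 1 = p - 2 by ring]
      field_simp
    refine h.congr_of_eventuallyEq ?_
    filter_upwards [gt_mem_nhds ht] with s hs
    rw [Real.sign_of_neg hs, abs_of_neg hs, neg_one_mul]
  · rcases hp.eq_or_lt with rfl | hp2
    · norm_num
      refine (hasDerivAt_id (0 : ℝ)).congr_of_eventuallyEq (.of_forall fun s => ?_)
      have := sign_mul_abs_rpow_sub_one 2 s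
      norm_num at this
      simpa using this
    · have h := ((hasDerivAt_abs_rpow (0 : ℝ) (p := p - 1) (by linarith)))
      rw [abs_zero, Real.zero_rpow (by linarith)]
      rw [hasDerivAt_iff_isLittleO_nhds_zero] at h ⊢
      simp only [mul_zero, smul_zero, sub_zero, zero_add, abs_zero, Real.sign_zero,
        zero_div, Real.zero_rpow hp1] at h ⊢
      refine Asymptotics.IsBigO.trans_isLittleO ?_ h
      refine Asymptotics.IsBigO.of_bound |(p - 1)⁻¹| (.of_forall fun s => ?_)
      rw [div_eq_inv_mul, norm_mul, norm_mul, Real.norm_eq_abs]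
      gcongr
      refine mul_le_of_le_one_left (norm_nonneg _) ?_
      rcases Real.sign_apply_eq s with h | h | h <;> simp [h]
  · have h : HasDerivAt (fun t : ℝ => t ^ (p - 1) / (p - 1)) (|t| ^ (p - 2)) t := by
      refine (((hasDerivAt_id t).rpow_const (p := p - 1)
        (Or.inr (by linarith))).div_const (p - 1)).congr_deriv ?_
      simp only [id, abs_of_pos ht]
      rw [show p - 1 - 1 = p - 2 by ring]
      field_simp
    refine h.congr_of_eventuallyEq ?_
    filter_upwards [lt_mem_nhds ht] with s hs
    rw [Real.sign_of_pos hs, abs_of_pos hs, one_mul]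

theorem integrable_mul_norm_add_abs_rpow {Ω : Type*} [MeasurableSpace Ω] {P : Measure Ω}
    {d : ℕ} {X : Ω → EuclideanSpace ℝ (Fin d)} {Y : Ω → ℝ} (hX : Measurable X) (hY : Measurable Y)
    {p : ℝ} (hp : 0 < p) (hYp : Integrable (fun ω => |Y ω| ^ p) P)
    (hXp : ∀ j : Fin d, Integrable (fun ω => |X ω j| ^ p) P) {c : ℝ} (hc : 0 ≤ c) :
    Integrable (fun ω => (c * ‖X ω‖ + |Y ω|) ^ p) P := by
  have key : ∀ {Z : Ω → ℝ}, Measurable Z → (Integrable (fun ω => |Z ω| ^ p) P ↔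
      MemLp Z (ENNReal.ofReal p) P) := by
    intro Z hZ
    rw [← integrable_norm_rpow_iff hZ.aestronglyMeasurable (by simpa using hp) (by simp),
      ENNReal.toReal_ofReal hp.le]
    rfl
  have hXm : MemLp X (ENNReal.ofReal p) P :=
    MemLp.of_eval_piLp fun j => (key (by fun_prop)).1 (hXp j)
  have hYm := (key hY).1 hYp
  have h := (key (by fun_prop)).2 ((hXm.norm.const_mul c).add hYm.norm)
  refine h.congr (.of_forall fun ω => ?_)
  have h0 : 0 ≤ c * ‖X ω‖ + |Y ω| := by positivity
  simp [abs_of_nonneg h0]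

/-- twice differentiability of the risk for `p ∈ [2, ∞)`
(Lemma `lem:twice_diff_pgeq2`): the gradient `∇R_p(w) = E[ℓ_p'(⟨w, X⟩ − Y) X]` exists
everywhere and is differentiable, with derivative the linear map induced by the Hessian
matrix `∇²R_p(w) = E[|⟨w, X⟩ − Y|^{p−2} X Xᵀ]`. -/
theorem risk_twice_differentiable_p_ge_two
    {Ω : Type*} [MeasurableSpace Ω] (P : Measure Ω) [IsProbabilityMeasure P]
    {d : ℕ} (X : Ω → EuclideanSpace ℝ (Fin d)) (Y : Ω → ℝ)
    (hX : Measurable X) (hY : Measurable Y)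
    (p : ℝ) (hp : 2 ≤ p)
    (hYp : Integrable (fun ω => |Y ω| ^ p) P)
    (hXp : ∀ j : Fin d, Integrable (fun ω => |X ω j| ^ p) P)
    (Rp : EuclideanSpace ℝ (Fin d) → ℝ)
    (hRp : Rp = fun w => ∫ ω, |⟪w, X ω⟫ - Y ω| ^ p / (p * (p - 1)) ∂P)
    (G : EuclideanSpace ℝ (Fin d) → EuclideanSpace ℝ (Fin d))
    (hG : G = fun w =>
      ∫ ω, (Real.sign (⟪w, X ω⟫ - Y ω) * |⟪w, X ω⟫ - Y ω| ^ (p - 1) / (p - 1)) • X ω ∂P)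
    (H : EuclideanSpace ℝ (Fin d) → Matrix (Fin d) (Fin d) ℝ)
    (hH : H = fun w => Matrix.of fun i j =>
      ∫ ω, |⟪w, X ω⟫ - Y ω| ^ (p - 2) * (X ω i * X ω j) ∂P) :
    ∀ w : EuclideanSpace ℝ (Fin d),
      HasGradientAt Rp (G w) w ∧
      HasFDerivAt G ((Matrix.toEuclideanLin (H w)).toContinuousLinearMap) w := by
  subst hRp hG hH
  intro w
  have hp1 : 1 ≤ p - 1 := by linarith
  have hB := integrable_mul_norm_add_abs_rpow hX hY (by linarith) hYp hXp
    (c := ‖w‖ + 1) (by positivity)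
  have hXB : ∀ ω, ‖X ω‖ ≤ (‖w‖ + 1) * ‖X ω‖ + |Y ω| := fun ω => by
    nlinarith [mul_nonneg (norm_nonneg w) (norm_nonneg (X ω)), abs_nonneg (Y ω)]
  have hresB : ∀ ω, |⟪w, X ω⟫ - Y ω| ≤ (‖w‖ + 1) * ‖X ω‖ + |Y ω| := fun ω => by
    have h1 := abs_sub ⟪w, X ω⟫ (Y ω)
    have h2 := abs_real_inner_le_norm w (X ω)
    nlinarith [norm_nonneg (X ω)]
  have hpow : ∀ {b : ℝ}, 0 ≤ b → b ^ (p - 1) * b = b ^ p ∧ b ^ (p - 2) * b * b = b ^ p := by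
    intro b hb
    have h1 := Real.rpow_add_of_nonneg hb (by linarith : 0 ≤ p - 1) zero_le_one
    have h2 := Real.rpow_add_of_nonneg hb (by linarith : 0 ≤ p - 2) zero_le_two
    rw [sub_add_cancel] at h1 h2
    rw [Real.rpow_one] at h1
    rw [Real.rpow_two] at h2
    exact ⟨h1.symm, by rw [h2]; ring⟩
  have hsign : ∀ t : ℝ, |Real.sign t * |t| ^ (p - 1) / (p - 1)| ≤ |t| ^ (p - 1) := by
    intro t
    have h0 : 0 ≤ |t| ^ (p - 1) := by positivity
    rw [abs_div, abs_mul, abs_of_nonneg h0, abs_of_pos (by linarith : 0 < p - 1)]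
    refine (div_le_self (by positivity) hp1).trans (mul_le_of_le_one_left h0 ?_)
    rcases Real.sign_apply_eq t with h | h | h <;> simp [h]
  have hgrad : ∀ ω t, |t| ≤ (‖w‖ + 1) * ‖X ω‖ + |Y ω| →
      |Real.sign t * |t| ^ (p - 1) / (p - 1)| * ‖X ω‖ ≤
        ((‖w‖ + 1) * ‖X ω‖ + |Y ω|) ^ p := by
    intro ω t ht
    rw [← (hpow (by positivity : 0 ≤ (‖w‖ + 1) * ‖X ω‖ + |Y ω|)).1]
    exact mul_le_mul ((hsign t).trans (Real.rpow_le_rpow (abs_nonneg _) ht (by linarith)))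
      (hXB ω) (norm_nonneg _) (by positivity)
  have hres : Measurable fun ω => ⟪w, X ω⟫ - Y ω := (measurable_const.inner hX).sub hY
  have hsignm : Measurable fun t : ℝ => Real.sign t * |t| ^ (p - 1) / (p - 1) :=
    (continuous_iff_continuousAt.2 fun t =>
      (hasDerivAt_sign_mul_abs_rpow_div hp t).continuousAt).measurable
  have hintR : Integrable (fun ω => |⟪w, X ω⟫ - Y ω| ^ p / (p * (p - 1))) P := by
    refine Integrable.div_const (hB.mono' (hres.abs.pow_const p).aestronglyMeasurable (.of_forall fun ω => ?_)) _
    rw [Real.norm_of_nonneg (by positivity)]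
    exact Real.rpow_le_rpow (abs_nonneg _) (hresB ω) (by linarith)
  have hintG : Integrable (fun ω => (Real.sign (⟪w, X ω⟫ - Y ω) *
      |⟪w, X ω⟫ - Y ω| ^ (p - 1) / (p - 1)) • X ω) P := by
    refine hB.mono' ((hsignm.comp hres).smul hX).aestronglyMeasurable (.of_forall fun ω => ?_)
    rw [norm_smul, Real.norm_eq_abs]
    exact hgrad ω _ (hresB ω)
  constructor
  · obtain ⟨hi, hd⟩ := hasFDerivAt_integral_residual_smul (P := P) (V := fun _ => (1 : ℝ))
      hX hY aestronglyMeasurable_const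
      (fun t => hasDerivAt_abs_rpow_div (by linarith : 1 < p) t) hsignm hB
      (fun ω t ht => by simpa using hgrad ω t ht) (by simpa using hintR)
    simp only [smul_eq_mul, mul_one] at hd
    rw [hasGradientAt_iff_hasFDerivAt]
    refine hd.congr_fderiv ?_
    symm
    refine ContinuousLinearMap.ext fun v => ?_
    rw [ContinuousLinearMap.integral_apply hi, InnerProductSpace.toDual_apply_apply,
      real_inner_comm, ← integral_inner hintG]
    refine integral_congr_ae (.of_forall fun ω => ?_)
    simp [inner_smul_right, real_inner_comm]
  · obtain ⟨hi, hd⟩ := hasFDerivAt_integral_residual_smul (P := P) (V := X)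
      hX hY hX.aestronglyMeasurable
      (fun t => hasDerivAt_sign_mul_abs_rpow_div hp t) (by fun_prop) hB
      (fun ω t ht => by
        rw [← (hpow (by positivity : 0 ≤ (‖w‖ + 1) * ‖X ω‖ + |Y ω|)).2,
          abs_of_nonneg (by positivity)]
        have h := Real.rpow_le_rpow (abs_nonneg _) ht (by linarith : 0 ≤ p - 2)
        have hX' := hXB ω
        gcongr) hintG
    refine hd.congr_fderiv ?_
    symm
    have hij : ∀ i j, Integrable
        (fun ω => |⟪w, X ω⟫ - Y ω| ^ (p - 2) * (X ω i * X ω j)) P := by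
      intro i j
      have h := (EuclideanSpace.proj (𝕜 := ℝ) i).integrable_comp
        (hi.apply_continuousLinearMap (EuclideanSpace.single j 1))
      refine h.congr (.of_forall fun ω => ?_)
      simp [EuclideanSpace.inner_single_right]
      ring
    ext v i
    rw [ContinuousLinearMap.integral_apply hi]
    change _ = EuclideanSpace.proj (𝕜 := ℝ) i _
    rw [← ContinuousLinearMap.integral_comp_comm _ (hi.apply_continuousLinearMap v)]
    simp only [LinearMap.coe_toContinuousLinearMap', Matrix.toLpLin_apply, Matrix.mulVec,
      dotProduct, Matrix.of_apply]
    simp_rw [← integral_mul_const]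
    rw [← integral_finsetSum _ fun j _ => (hij i j).mul_const _]
    refine integral_congr_ae (.of_forall fun ω => ?_)
    simp [PiLp.inner_apply, Finset.mul_sum, Finset.sum_mul]
    refine Finset.sum_congr rfl fun j _ => ?_
    ring
end

section
/- Let p ∈ (1, 2) and let (X, Y) be a random pair in ℝ^d × ℝ with E[|Y|^p] < ∞ and E[|X^j|^p] < ∞ for all j ∈ {1,…,d}, and let w*_p be a minimizer of R_p. Assume P(|⟨w*_p, X⟩ − Y| = 0) = 0 and E[|⟨w*_p, X⟩ − Y|^{p−2} (X^j)²] < ∞ for all j ∈ {1,…,d}. Then R_p is twice (Fréchet) differentiable at w*_p, with Hessian ∇²R_p(w*_p) = E[|⟨w*_p, X⟩ − Y|^{p−2} X Xᵀ]. -/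
open MeasureTheory RealInnerProductSpace

/-- The signed power `t ↦ sign t * |t| ^ r`, written without the sign function. -/
theorem sign_mul_abs_rpow (t r : ℝ) : Real.sign t * |t| ^ r = |t| ^ (r - 1) * t := by
  rcases lt_trichotomy t 0 with ht | rfl | ht
  · rw [Real.sign_of_neg ht, Real.rpow_sub_one (abs_pos.2 ht.ne).ne', abs_of_neg ht,
      div_mul_comm, div_neg, div_self ht.ne]
  · simp
  · rw [Real.sign_of_pos ht, Real.rpow_sub_one (abs_pos.2 ht.ne').ne', abs_of_pos ht]
    field_simp

theorem abs_abs_rpow_sub_one_mul_self {r : ℝ} (hr : 0 < r) (t : ℝ) :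
    |(|t| ^ (r - 1) * t)| = |t| ^ r := by
  rcases eq_or_ne t 0 with rfl | ht
  · simp [Real.zero_rpow hr.ne']
  · rw [abs_mul, abs_of_nonneg (Real.rpow_nonneg (abs_nonneg t) _),
      Real.rpow_sub_one (abs_pos.2 ht).ne']
    field_simp

/-- Away from the origin, the signed power of exponent `r` has derivative `r * |t| ^ (r - 1)`. -/
theorem hasDerivAt_abs_rpow_sub_one_mul_self {t : ℝ} (ht : t ≠ 0) (r : ℝ) :
    HasDerivAt (fun s : ℝ => |s| ^ (r - 1) * s) (r * |t| ^ (r - 1)) t := by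
  have h := ((hasDerivAt_abs ht).rpow_const (p := r - 1) (Or.inl (abs_pos.2 ht).ne')).mul
    (hasDerivAt_id t)
  refine h.congr_deriv ?_
  have hs : (SignType.sign t : ℝ) * t = |t| := sign_mul_self t
  have hpos := abs_pos.2 ht
  rw [Real.rpow_sub_one hpos.ne' (r - 1)]
  simp only [id]
  calc _ = ((SignType.sign t : ℝ) * t) * (r - 1) * (|t| ^ (r - 1) / |t|) + |t| ^ (r - 1) := by ring
    _ = _ := by rw [hs]; field_simp; ring

/-- A Lipschitz-type bound for the signed power of exponent `r ≤ 1` which is pointwise at `t` and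
global in `s`. -/
theorem abs_abs_rpow_sub_one_mul_self_sub_le {r : ℝ} (hr0 : 0 < r) (hr1 : r ≤ 1) {t : ℝ}
    (ht : t ≠ 0) (s : ℝ) :
    |(|s| ^ (r - 1) * s - |t| ^ (r - 1) * t)| ≤ 2 * |t| ^ (r - 1) * |s - t| := by
  wlog hpos : 0 < t generalizing s t
  · have h := this (neg_ne_zero.2 ht) (-s)
      (neg_pos.2 (lt_of_le_of_ne (not_lt.1 hpos) ht))
    rw [abs_neg, abs_neg, mul_neg, mul_neg, ← neg_sub', abs_neg, ← neg_sub', abs_neg] at h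
    exact h
  have hB : 0 < |t| ^ (r - 1) := Real.rpow_pos_of_pos (abs_pos.2 ht) _
  have hA : 0 ≤ |s| ^ (r - 1) := Real.rpow_nonneg (abs_nonneg s) _
  have key : ∀ u : ℝ, |u| ^ (r - 1) * |u| = |u| ^ r := fun u => by
    rw [← abs_abs_rpow_sub_one_mul_self hr0 u, abs_mul,
      abs_of_nonneg (Real.rpow_nonneg (abs_nonneg u) _)]
  have kt := key t
  have ks := key s
  rcases eq_or_ne s 0 with rfl | hs
  · simp only [mul_zero, zero_sub, abs_neg, abs_mul, abs_of_pos hB]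
    nlinarith [mul_nonneg hB.le (abs_nonneg t)]
  rcases le_total |s| |t| with hst | hst
  · have h1 : |t| ^ (r - 1) ≤ |s| ^ (r - 1) :=
      Real.rpow_le_rpow_of_nonpos (abs_pos.2 hs) hst (by linarith)
    have h2 : |s| ^ r ≤ |t| ^ r := Real.rpow_le_rpow (abs_nonneg s) hst hr0.le
    rw [← kt, ← ks] at h2
    generalize |t| ^ (r - 1) = B at *
    generalize |s| ^ (r - 1) = A at *
    rw [abs_of_pos hpos] at h2 hst
    rcases lt_or_gt_of_ne hs with hs' | hs'
    · rw [abs_of_neg hs'] at h2 hst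
      rw [abs_of_neg (by linarith : s - t < 0), abs_le]
      constructor <;> nlinarith
    · rw [abs_of_pos hs'] at h2 hst
      rw [abs_of_nonpos (by linarith : s - t ≤ 0), abs_le]
      constructor <;> nlinarith
  · have h1 : |s| ^ (r - 1) ≤ |t| ^ (r - 1) :=
      Real.rpow_le_rpow_of_nonpos (abs_pos.2 ht) hst (by linarith)
    have h2 : |t| ^ r ≤ |s| ^ r := Real.rpow_le_rpow (abs_nonneg t) hst hr0.le
    rw [← kt, ← ks] at h2
    generalize |t| ^ (r - 1) = B at *
    generalize |s| ^ (r - 1) = A at *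
    rw [abs_of_pos hpos] at h2 hst
    rcases lt_or_gt_of_ne hs with hs' | hs'
    · rw [abs_of_neg hs'] at h2 hst
      rw [abs_of_neg (by linarith : s - t < 0), abs_le]
      constructor <;> nlinarith
    · rw [abs_of_pos hs'] at h2 hst
      rw [abs_of_nonneg (by linarith : 0 ≤ s - t), abs_le]
      constructor <;> nlinarith

section Risk

variable {Ω : Type*} [MeasurableSpace Ω] {P : Measure Ω}

/-- A Euclidean random vector with `p`-integrable coordinates is in `L^p`. -/
theorem memLp_euclideanSpace_of_integrable_abs_rpow {d : ℕ} {X : Ω → EuclideanSpace ℝ (Fin d)}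
    (hX : Measurable X) {p : ℝ} (hp : 0 < p)
    (hXp : ∀ j : Fin d, Integrable (fun ω => |X ω j| ^ p) P) :
    MemLp X (ENNReal.ofReal p) P := by
  have hcoord : ∀ j : Fin d, MemLp (fun ω => X ω j) (ENNReal.ofReal p) P := fun j => by
    rw [← integrable_norm_rpow_iff (by fun_prop) (by simp [hp]) (by simp),
      ENNReal.toReal_ofReal hp.le]
    exact hXp j
  have hsum := memLp_finsetSum Finset.univ fun (j : Fin d) _ => (hcoord j).norm
  refine hsum.mono hX.aestronglyMeasurable (Filter.Eventually.of_forall fun ω => ?_)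
  rw [Real.norm_of_nonneg (Finset.sum_nonneg fun j _ => norm_nonneg _),
    EuclideanSpace.norm_eq]
  refine Real.sqrt_le_iff.2 ⟨Finset.sum_nonneg fun j _ => norm_nonneg _, ?_⟩
  exact Finset.sum_sq_le_sq_sum_of_nonneg fun j _ => norm_nonneg _

/-- The map induced by the matrix of weighted second moments is the integral of the weighted
rank-one maps. -/
theorem integral_smul_rankOne_eq_toEuclideanLin {d : ℕ} {X : Ω → EuclideanSpace ℝ (Fin d)}
    {c : Ω → ℝ} (h_int : Integrable (fun ω => c ω • InnerProductSpace.rankOne ℝ (X ω) (X ω)) P) :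
    ∫ ω, c ω • InnerProductSpace.rankOne ℝ (X ω) (X ω) ∂P =
      (Matrix.toEuclideanLin
        (Matrix.of fun i j => ∫ ω, c ω * (X ω i * X ω j) ∂P)).toContinuousLinearMap := by
  refine ContinuousLinearMap.coe_injective
    ((EuclideanSpace.basisFun (Fin d) ℝ).toBasis.ext fun j => ?_)
  ext i
  have happ := h_int.apply_continuousLinearMap (EuclideanSpace.basisFun (Fin d) ℝ j)
  have hproj := (EuclideanSpace.proj (𝕜 := ℝ) i).integral_comp_comm happ
  simp only [OrthonormalBasis.coe_toBasis, ContinuousLinearMap.coe_coe,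
    LinearMap.coe_toContinuousLinearMap]
  rw [ContinuousLinearMap.integral_apply h_int]
  refine hproj.symm.trans ?_
  simp [Matrix.toLpLin_apply, EuclideanSpace.inner_single_right, mul_comm]

variable {d : ℕ} {X : Ω → EuclideanSpace ℝ (Fin d)} {Y : Ω → ℝ} {p : ℝ}

theorem hasFDerivAt_inner_sub_const {E : Type*} [NormedAddCommGroup E] [InnerProductSpace ℝ E]
    (x : E) (y : ℝ) (w : E) : HasFDerivAt (fun v : E => ⟪v, x⟫ - y) (innerSL ℝ x) w := by
  have h := ((innerSL ℝ x).hasFDerivAt (x := w)).sub_const y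
  simpa [real_inner_comm] using h

theorem integrable_abs_inner_sub_rpow (hX : MemLp X (ENNReal.ofReal p) P)
    (hY : MemLp Y (ENNReal.ofReal p) P) (hp : 0 < p) (w : EuclideanSpace ℝ (Fin d)) :
    Integrable (fun ω => |⟪w, X ω⟫ - Y ω| ^ p) P := by
  have h := ((hX.const_inner w).sub hY).integrable_norm_rpow (by simp [hp]) (by simp)
  rw [ENNReal.toReal_ofReal hp.le] at h
  exact h

/-- On the unit ball around `w`, the integrand of the `p`-moment gradient is bounded uniformly. -/
theorem norm_signed_rpow_smul_le {E : Type*} [NormedAddCommGroup E] [InnerProductSpace ℝ E]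
    (hp : 1 < p) {w v : E} (hv : v ∈ Metric.ball w 1) (x : E) (y : ℝ) :
    ‖(|⟪v, x⟫ - y| ^ (p - 1 - 1) * (⟪v, x⟫ - y)) • x‖ ≤ ((‖w‖ + 1) * ‖x‖ + |y|) ^ p := by
  have hvn : ‖v‖ ≤ ‖w‖ + 1 := by
    have := norm_le_norm_add_norm_sub' v w
    rw [mem_ball_iff_norm] at hv
    linarith
  have ha : |⟪v, x⟫ - y| ≤ (‖w‖ + 1) * ‖x‖ + |y| := by
    calc |⟪v, x⟫ - y| ≤ |⟪v, x⟫| + |y| := abs_sub _ _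
      _ ≤ ‖v‖ * ‖x‖ + |y| := by gcongr; exact abs_real_inner_le_norm v x
      _ ≤ _ := by gcongr
  have hx : ‖x‖ ≤ (‖w‖ + 1) * ‖x‖ + |y| := by
    nlinarith [abs_nonneg y, mul_nonneg (norm_nonneg w) (norm_nonneg x)]
  have h0 : 0 ≤ (‖w‖ + 1) * ‖x‖ + |y| := by positivity
  rw [norm_smul, Real.norm_eq_abs, abs_abs_rpow_sub_one_mul_self (by linarith)]
  calc _ ≤ ((‖w‖ + 1) * ‖x‖ + |y|) ^ (p - 1) * ((‖w‖ + 1) * ‖x‖ + |y|) := by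
        gcongr
    _ = _ := by
        rw [← Real.rpow_add_one' h0 (by linarith)]
        ring_nf

theorem integrable_norm_add_abs_rpow (hX : MemLp X (ENNReal.ofReal p) P)
    (hY : MemLp Y (ENNReal.ofReal p) P) (hp : 0 < p) (w : EuclideanSpace ℝ (Fin d)) :
    Integrable (fun ω => ((‖w‖ + 1) * ‖X ω‖ + |Y ω|) ^ p) P := by
  have h := ((hX.norm.const_mul (‖w‖ + 1)).add hY.norm).integrable_norm_rpow (by simp [hp])
    (by simp)
  rw [ENNReal.toReal_ofReal hp.le] at h
  refine h.congr (Filter.Eventually.of_forall fun ω => ?_)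
  have : 0 ≤ (‖w‖ + 1) * ‖X ω‖ + ‖Y ω‖ := by positivity
  simp only [Pi.add_apply]
  rw [Real.norm_of_nonneg this, Real.norm_eq_abs]

theorem measurable_signed_rpow_smul (hX : Measurable X) (hY : Measurable Y) (r : ℝ)
    (w : EuclideanSpace ℝ (Fin d)) :
    Measurable fun ω => (|⟪w, X ω⟫ - Y ω| ^ r * (⟪w, X ω⟫ - Y ω)) • X ω := by
  have hu : Measurable fun ω => ⟪w, X ω⟫ - Y ω := (hX.const_inner).sub hY
  have ha : Measurable fun ω => |⟪w, X ω⟫ - Y ω| := continuous_abs.measurable.comp hu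
  exact ((ha.pow_const r).mul hu).smul hX

theorem integrable_signed_rpow_smul (hX : Measurable X) (hY : Measurable Y)
    (hXp : MemLp X (ENNReal.ofReal p) P) (hYp : MemLp Y (ENNReal.ofReal p) P) (hp : 1 < p)
    (w : EuclideanSpace ℝ (Fin d)) :
    Integrable (fun ω => (|⟪w, X ω⟫ - Y ω| ^ (p - 1 - 1) * (⟪w, X ω⟫ - Y ω)) • X ω) P :=
  (integrable_norm_add_abs_rpow hXp hYp (by linarith) w).mono'
    (measurable_signed_rpow_smul hX hY _ w).aestronglyMeasurable
    (Filter.Eventually.of_forall fun _ =>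
      norm_signed_rpow_smul_le hp (Metric.mem_ball_self one_pos) _ _)

theorem hasGradientAt_integral_abs_inner_sub_rpow (hX : Measurable X) (hY : Measurable Y)
    (hXp : MemLp X (ENNReal.ofReal p) P) (hYp : MemLp Y (ENNReal.ofReal p) P) (hp : 1 < p)
    (w : EuclideanSpace ℝ (Fin d)) :
    HasGradientAt (fun w => ∫ ω, |⟪w, X ω⟫ - Y ω| ^ p ∂P)
      (p • ∫ ω, (|⟪w, X ω⟫ - Y ω| ^ (p - 1 - 1) * (⟪w, X ω⟫ - Y ω)) • X ω ∂P) w := by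
  have h_int := fun v => integrable_abs_inner_sub_rpow hXp hYp (by linarith) v
  have hG := integrable_signed_rpow_smul hX hY hXp hYp hp w
  have h := hasFDerivAt_integral_of_dominated_of_fderiv_le (𝕜 := ℝ) (μ := P)
    (F := fun (w : EuclideanSpace ℝ (Fin d)) ω => |⟪w, X ω⟫ - Y ω| ^ p)
    (F' := fun w ω => innerSL ℝ (p • (|⟪w, X ω⟫ - Y ω| ^ (p - 1 - 1) * (⟪w, X ω⟫ - Y ω)) • X ω))
    (bound := fun ω => p * ((‖w‖ + 1) * ‖X ω‖ + |Y ω|) ^ p)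
    (Metric.ball_mem_nhds w one_pos)
    (Filter.Eventually.of_forall fun v => (h_int v).aestronglyMeasurable) (h_int w)
    ((innerSL ℝ).continuous.comp_aestronglyMeasurable
      (hG.aestronglyMeasurable.const_smul p))
    (Filter.Eventually.of_forall fun ω v hv => ?_)
    ((integrable_norm_add_abs_rpow hXp hYp (by linarith) w).const_mul p)
    (Filter.Eventually.of_forall fun ω v _ => ?_)
  · rw [hasGradientAt_iff_hasFDerivAt]
    refine h.congr_fderiv ?_
    rw [← integral_smul]
    exact (innerSL ℝ).integral_comp_comm (hG.smul p)
  · rw [innerSL_apply_norm, norm_smul, Real.norm_of_nonneg (by linarith)]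
    exact mul_le_mul_of_nonneg_left (norm_signed_rpow_smul_le hp hv _ _) (by linarith)
  · have hd := (hasDerivAt_abs_rpow (⟪v, X ω⟫ - Y ω) hp).comp_hasFDerivAt v
      (hasFDerivAt_inner_sub_const (X ω) (Y ω) v)
    refine hd.congr_fderiv ?_
    rw [map_smul, map_smul, smul_smul, sub_sub, one_add_one_eq_two, mul_assoc]

/-- Differentiability of the `p`-moment gradient at a point where the residual almost surely does
not vanish and the weighted second moments are finite. -/
theorem hasFDerivAt_integral_signed_rpow_smul (hX : Measurable X) (hY : Measurable Y)
    (hXp : MemLp X (ENNReal.ofReal p) P) (hYp : MemLp Y (ENNReal.ofReal p) P) (hp : 1 < p)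
    (hp2 : p ≤ 2) {w : EuclideanSpace ℝ (Fin d)} (hne : ∀ᵐ ω ∂P, ⟪w, X ω⟫ - Y ω ≠ 0)
    (hmix : ∀ j : Fin d, Integrable (fun ω => |⟪w, X ω⟫ - Y ω| ^ (p - 1 - 1) * (X ω j) ^ 2) P) :
    Integrable (fun ω => ((p - 1) * |⟪w, X ω⟫ - Y ω| ^ (p - 1 - 1)) •
        InnerProductSpace.rankOne ℝ (X ω) (X ω)) P ∧
      HasFDerivAt
        (fun w => ∫ ω, (|⟪w, X ω⟫ - Y ω| ^ (p - 1 - 1) * (⟪w, X ω⟫ - Y ω)) • X ω ∂P)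
        (∫ ω, ((p - 1) * |⟪w, X ω⟫ - Y ω| ^ (p - 1 - 1)) •
          InnerProductSpace.rankOne ℝ (X ω) (X ω) ∂P) w := by
  have hbound : Integrable (fun ω => 2 * (|⟪w, X ω⟫ - Y ω| ^ (p - 1 - 1) * ‖X ω‖ ^ 2)) P := by
    refine ((integrable_finsetSum Finset.univ fun j _ => hmix j).const_mul 2).congr
      (Filter.Eventually.of_forall fun ω => ?_)
    simp only [EuclideanSpace.real_norm_sq_eq, Finset.mul_sum]
  have hw : Measurable fun ω => (p - 1) * |⟪w, X ω⟫ - Y ω| ^ (p - 1 - 1) := by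
    have hu : Measurable fun ω => ⟪w, X ω⟫ - Y ω := (hX.const_inner).sub hY
    have ha : Measurable fun ω => |⟪w, X ω⟫ - Y ω| := continuous_abs.measurable.comp hu
    exact (ha.pow_const _).const_mul _
  have hrank : Continuous fun x : EuclideanSpace ℝ (Fin d) =>
      InnerProductSpace.rankOne ℝ x x :=
    ((InnerProductSpace.rankOne ℝ).continuous).clm_apply continuous_id
  refine hasFDerivAt_integral_of_dominated_loc_of_lip' Filter.univ_mem
    (fun v _ => (measurable_signed_rpow_smul hX hY _ v).aestronglyMeasurable)
    (integrable_signed_rpow_smul hX hY hXp hYp hp w)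
    (hw.aestronglyMeasurable.smul (hrank.comp_aestronglyMeasurable hX.aestronglyMeasurable))
    ?_ hbound ?_
  · filter_upwards [hne] with ω hω v _
    rw [← sub_smul, norm_smul, Real.norm_eq_abs]
    have h1 := abs_abs_rpow_sub_one_mul_self_sub_le (by linarith : 0 < p - 1) (by linarith) hω
      (⟪v, X ω⟫ - Y ω)
    rw [sub_sub_sub_cancel_right, ← inner_sub_left] at h1
    calc _ ≤ 2 * |⟪w, X ω⟫ - Y ω| ^ (p - 1 - 1) * |⟪v - w, X ω⟫| * ‖X ω‖ := by gcongr
      _ ≤ 2 * |⟪w, X ω⟫ - Y ω| ^ (p - 1 - 1) * (‖v - w‖ * ‖X ω‖) * ‖X ω‖ := by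
        gcongr
        exact abs_real_inner_le_norm _ _
      _ = _ := by ring
  · filter_upwards [hne] with ω hω
    have hd := ((hasDerivAt_abs_rpow_sub_one_mul_self hω (p - 1)).comp_hasFDerivAt w
      (hasFDerivAt_inner_sub_const (X ω) (Y ω) w)).smul_const (X ω)
    refine hd.congr_fderiv ?_
    ext v
    simp [smul_smul]

end Risk

/-- twice differentiability of the risk at the minimizer for `p ∈ (1, 2)`:
the gradient `∇R_p(w) = E[ℓ_p'(⟨w, X⟩ − Y) X]` exists everywhere and is differentiable at
`w*_p`, with derivative the linear map induced by the Hessian matrix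
`∇²R_p(w*_p) = E[|⟨w*_p, X⟩ − Y|^{p−2} X Xᵀ]`. -/
theorem risk_twice_differentiable_at_minimizer_p_lt_two
    {Ω : Type*} [MeasurableSpace Ω] (P : Measure Ω) [IsProbabilityMeasure P]
    {d : ℕ} (X : Ω → EuclideanSpace ℝ (Fin d)) (Y : Ω → ℝ)
    (hX : Measurable X) (hY : Measurable Y)
    (p : ℝ) (hp1 : 1 < p) (hp2 : p < 2)
    (hYp : Integrable (fun ω => |Y ω| ^ p) P)
    (hXp : ∀ j : Fin d, Integrable (fun ω => |X ω j| ^ p) P)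
    (Rp : EuclideanSpace ℝ (Fin d) → ℝ)
    (hRp : Rp = fun w => ∫ ω, |⟪w, X ω⟫ - Y ω| ^ p / (p * (p - 1)) ∂P)
    (wstar : EuclideanSpace ℝ (Fin d)) (hstar : ∀ w, Rp wstar ≤ Rp w)
    (hne : P {ω | |⟪wstar, X ω⟫ - Y ω| = 0} = 0)
    (hmix : ∀ j : Fin d, Integrable
      (fun ω => |⟪wstar, X ω⟫ - Y ω| ^ (p - 2) * (X ω j) ^ 2) P)
    (G : EuclideanSpace ℝ (Fin d) → EuclideanSpace ℝ (Fin d))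
    (hG : G = fun w =>
      ∫ ω, (Real.sign (⟪w, X ω⟫ - Y ω) * |⟪w, X ω⟫ - Y ω| ^ (p - 1) / (p - 1)) • X ω ∂P)
    (Hstar : Matrix (Fin d) (Fin d) ℝ)
    (hHstar : Hstar = Matrix.of fun i j =>
      ∫ ω, |⟪wstar, X ω⟫ - Y ω| ^ (p - 2) * (X ω i * X ω j) ∂P) :
    (∀ w : EuclideanSpace ℝ (Fin d), HasGradientAt Rp (G w) w) ∧
      HasFDerivAt G ((Matrix.toEuclideanLin Hstar).toContinuousLinearMap) wstar := by
  have hXL := memLp_euclideanSpace_of_integrable_abs_rpow hX (by linarith : 0 < p) hXp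
  have hYL : MemLp Y (ENNReal.ofReal p) P := by
    rw [← integrable_norm_rpow_iff (by fun_prop) (by simp; linarith) (by simp),
      ENNReal.toReal_ofReal (by linarith)]
    exact hYp
  have hG' : G = fun w => (p - 1)⁻¹ •
      ∫ ω, (|⟪w, X ω⟫ - Y ω| ^ (p - 1 - 1) * (⟪w, X ω⟫ - Y ω)) • X ω ∂P := by
    rw [hG]
    funext w
    rw [← integral_smul]
    simp only [sign_mul_abs_rpow, smul_smul, div_eq_inv_mul]
  have hp1' : p - 1 ≠ 0 := by linarith
  constructor
  · intro w
    have h := (hasGradientAt_integral_abs_inner_sub_rpow hX hY hXL hYL hp1 w).hasFDerivAt.const_smul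
      (p * (p - 1))⁻¹
    rw [hasGradientAt_iff_hasFDerivAt, hRp, hG']
    simp only [div_eq_inv_mul, integral_const_mul]
    refine h.congr_fderiv ?_
    rw [← map_smul, smul_smul]
    congr 2
    field_simp
  · have hpp : p - 2 = p - 1 - 1 := by ring
    rw [hpp] at hmix hHstar
    have hne' : ∀ᵐ ω ∂P, ⟪wstar, X ω⟫ - Y ω ≠ 0 := by
      rw [ae_iff]
      simpa using hne
    obtain ⟨h_int, hd⟩ := hasFDerivAt_integral_signed_rpow_smul hX hY hXL hYL hp1 hp2.le hne' hmix
    rw [hG', hHstar]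
    refine (hd.const_smul (p - 1)⁻¹).congr_fderiv ?_
    have h_int' := h_int.fun_smul (p - 1)⁻¹
    rw [← integral_smul]
    simp only [smul_smul, inv_mul_cancel_left₀ hp1'] at h_int' ⊢
    exact integral_smul_rankOne_eq_toEuclideanLin h_int'
end
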